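/- Let E be a smooth homogeneous cubic in S = ℂ[z₀,…,z₄] with Jacobian ideal J. Let l ⊆ ℂ^5 be a line and let W ⊆ S^1 be the 3-dimensional space of linear forms vanishing on l. Then the following are equivalent: (a) there exists ξ ∈ S^3 with ξ ∉ J such that η·ξ ∈ J for every η ∈ W; (b) the image of W·S^1 in R^2 = S^2/J_2 is a hyperplane of the 10-dimensional space R^2 (i.e. has dimension 9); (c) dim_ℂ((W·S^1) ∩ J_2) = 3; (d) the space J_2|_l of restrictions to l of elements of J_2 has dimension 2. -/

import Mathlib

open MvPolynomial Module

noncomputable section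

/-- The Jacobian ideal of a polynomial `E`, generated by its five partial derivatives. -/
def jacobianIdeal (E : MvPolynomial (Fin 5) ℂ) : Ideal (MvPolynomial (Fin 5) ℂ) :=
  Ideal.span (Set.range fun i => pderiv i E)

/-- `E` is a smooth cubic: it is homogeneous of degree 3 and the only common zero of its
partial derivatives is the origin. -/
def IsSmoothCubic (E : MvPolynomial (Fin 5) ℂ) : Prop :=
  E.IsHomogeneous 3 ∧ ∀ x : Fin 5 → ℂ, (∀ i, eval x (pderiv i E) = 0) → x = 0

/-- Restriction of polynomials to (the points of) a subspace `l ⊆ ℂ⁵`, as functions on `l`. -/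
def restrictTo (l : Submodule ℂ (Fin 5 → ℂ)) :
    MvPolynomial (Fin 5) ℂ →ₗ[ℂ] (l → ℂ) :=
  LinearMap.pi fun x => (aeval (x : Fin 5 → ℂ)).toLinearMap

/-- The space `W` of linear forms vanishing on the subspace `l ⊆ ℂ⁵`. -/
def vanishingForms (l : Submodule ℂ (Fin 5 → ℂ)) : Submodule ℂ (MvPolynomial (Fin 5) ℂ) :=
  homogeneousSubmodule (Fin 5) ℂ 1 ⊓ LinearMap.ker (restrictTo l)

/-- `W·S¹`: the span of all products `η·η'` with `η ∈ W` and `η'` a linear form. -/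
def mulS1 (W : Submodule ℂ (MvPolynomial (Fin 5) ℂ)) : Submodule ℂ (MvPolynomial (Fin 5) ℂ) :=
  Submodule.span ℂ
    {p | ∃ η ∈ W, ∃ η' : MvPolynomial (Fin 5) ℂ, η'.IsHomogeneous 1 ∧ p = η * η'}

/-- The degree-2 part `J₂ = J ∩ S²` of the Jacobian ideal. -/
def J2 (E : MvPolynomial (Fin 5) ℂ) : Submodule ℂ (MvPolynomial (Fin 5) ℂ) :=
  (jacobianIdeal E).restrictScalars ℂ ⊓ homogeneousSubmodule (Fin 5) ℂ 2

namespace MvPolynomial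

section HomogeneousIdeals

variable {σ K : Type*} [Field K]

lemma homogeneousComponent_mul_of_isHomogeneous {f : MvPolynomial σ K} {e : ℕ}
    (hf : f.IsHomogeneous e) (a : MvPolynomial σ K) (d : ℕ) :
    homogeneousComponent (d + e) (f * a) = f * homogeneousComponent d a := by
  conv_lhs => rw [← sum_homogeneousComponent a, Finset.mul_sum, map_sum]
  have key : ∀ i, homogeneousComponent (d + e) (f * homogeneousComponent i a) =
      if i = d then f * homogeneousComponent i a else 0 := by
    intro i
    rw [homogeneousComponent_of_mem (hf.mul (homogeneousComponent_isHomogeneous i a))]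
    exact if_congr (by omega) rfl rfl
  simp_rw [key]
  rw [Finset.sum_ite_eq']
  split_ifs with h
  · rfl
  · rw [homogeneousComponent_eq_zero _ _ (by simpa using h), mul_zero]

lemma homogeneousComponent_mul_of_lt {f : MvPolynomial σ K} {e n : ℕ}
    (hf : f.IsHomogeneous e) (a : MvPolynomial σ K) (hn : n < e) :
    homogeneousComponent n (f * a) = 0 := by
  rw [← sum_homogeneousComponent a, Finset.mul_sum, map_sum]
  refine Finset.sum_eq_zero fun i _ => ?_
  rw [homogeneousComponent_of_mem (hf.mul (homogeneousComponent_isHomogeneous i a)),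
    if_neg (by omega)]

/-- An ideal closed under taking homogeneous components. -/
def IsHomogeneousIdeal (I : Ideal (MvPolynomial σ K)) : Prop :=
  ∀ p ∈ I, ∀ d, homogeneousComponent d p ∈ I

lemma IsHomogeneousIdeal.sup {I J : Ideal (MvPolynomial σ K)} (hI : IsHomogeneousIdeal I)
    (hJ : IsHomogeneousIdeal J) : IsHomogeneousIdeal (I ⊔ J) := by
  intro p hp d
  obtain ⟨a, ha, b, hb, rfl⟩ := Submodule.mem_sup.1 hp
  rw [map_add]
  exact Submodule.add_mem_sup (hI a ha d) (hJ b hb d)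

lemma isHomogeneousIdeal_span {s : Set (MvPolynomial σ K)}
    (hs : ∀ f ∈ s, ∃ e, f.IsHomogeneous e) : IsHomogeneousIdeal (Ideal.span s) := by
  intro p hp d
  induction hp using Submodule.span_induction generalizing d with
  | mem f hf =>
    obtain ⟨e, he⟩ := hs f hf
    rw [homogeneousComponent_of_mem he]
    split_ifs
    · exact Ideal.subset_span hf
    · exact zero_mem _
  | zero => simp
  | add p q _ _ hp hq => rw [map_add]; exact add_mem (hp d) (hq d)
  | smul a p _ hp =>
    rw [smul_eq_mul, mul_comm, ← sum_homogeneousComponent a, Finset.mul_sum, map_sum]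
    refine sum_mem fun i _ => ?_
    have hi := homogeneousComponent_isHomogeneous i a
    rw [mul_comm]
    rcases le_or_gt i d with h | h
    · obtain ⟨k, rfl⟩ := Nat.exists_eq_add_of_le' h
      rw [homogeneousComponent_mul_of_isHomogeneous hi]
      exact Ideal.mul_mem_left _ _ (hp k)
    · rw [homogeneousComponent_mul_of_lt hi _ h]
      exact zero_mem _

lemma isHomogeneousIdeal_span_singleton {f : MvPolynomial σ K} {e : ℕ} (hf : f.IsHomogeneous e) :
    IsHomogeneousIdeal (Ideal.span {f}) :=
  isHomogeneousIdeal_span fun _ h => ⟨e, by rwa [Set.mem_singleton_iff.1 h]⟩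

lemma IsHomogeneousIdeal.mem_of_homogeneousComponent {I : Ideal (MvPolynomial σ K)}
    {p : MvPolynomial σ K} (h : ∀ d, homogeneousComponent d p ∈ I) : p ∈ I := by
  rw [← sum_homogeneousComponent p]
  exact sum_mem fun i _ => h i

lemma mem_idealOfVars_pow {u : MvPolynomial σ K} {d N : ℕ} (hu : u.IsHomogeneous d) (h : N ≤ d) :
    u ∈ idealOfVars σ K ^ N := by
  rw [mem_pow_idealOfVars_iff]
  intro x hx
  exact h.trans_eq (hu.degree_eq_sum_deg_support hx)

lemma mem_idealOfVars {u : MvPolynomial σ K} {d : ℕ} (hu : u.IsHomogeneous d) (h : 1 ≤ d) :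
    u ∈ idealOfVars σ K := by
  simpa using mem_idealOfVars_pow hu h

lemma mul_mem_of_forall_X {I : Ideal (MvPolynomial σ K)} {u z : MvPolynomial σ K}
    (h : ∀ i, X i * u ∈ I) (hz : z ∈ idealOfVars σ K) : z * u ∈ I := by
  have : idealOfVars σ K ≤ Submodule.comap (LinearMap.toSpanSingleton (MvPolynomial σ K) _ u) I := by
    rw [idealOfVars, Ideal.span_le]
    rintro _ ⟨i, rfl⟩
    simpa using h i
  simpa using this hz

end HomogeneousIdeals

section Regular

variable {A : Type*} [CommRing A]

/-- Multiplication by `f` is injective modulo the ideal `I`. -/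
def IsRegularMod (I : Ideal A) (f : A) : Prop := ∀ u, f * u ∈ I → u ∈ I

lemma IsRegularMod.swap {I : Ideal A} {l f : A} (hl : IsRegularMod I l)
    (hf : IsRegularMod (I ⊔ Ideal.span {l}) f) : IsRegularMod (I ⊔ Ideal.span {f}) l := by
  intro u hu
  obtain ⟨i, hi, b, hb, h⟩ := Submodule.mem_sup.1 hu
  obtain ⟨v, rfl⟩ := Ideal.mem_span_singleton'.1 hb
  have hv : v ∈ I ⊔ Ideal.span {l} := by
    refine hf v (Submodule.mem_sup.2 ⟨-i, neg_mem hi, u * l,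
      Ideal.mem_span_singleton'.2 ⟨u, rfl⟩, ?_⟩)
    linear_combination -h
  obtain ⟨j, hj, c, hc, rfl⟩ := Submodule.mem_sup.1 hv
  obtain ⟨w, rfl⟩ := Ideal.mem_span_singleton'.1 hc
  have hk : u - w * f ∈ I := by
    refine hl _ ?_
    have : l * (u - w * f) = i + j * f := by linear_combination -h
    rw [this]
    exact add_mem hi (Ideal.mul_mem_right _ _ hj)
  exact Submodule.mem_sup.2 ⟨_, hk, w * f, Ideal.mem_span_singleton'.2 ⟨w, rfl⟩, by ring⟩

lemma IsRegularMod.pow {I : Ideal A} {l : A} (hl : IsRegularMod I l) (n : ℕ) :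
    IsRegularMod I (l ^ n) := by
  induction n with
  | zero => intro u hu; simpa using hu
  | succ n ih => exact fun u hu => hl _ (ih _ (by rwa [← mul_assoc, ← pow_succ]))

lemma IsRegularMod.of_mem_radical {I : Ideal A} {l f : A} (hl : IsRegularMod I l)
    (h : l ∈ (I ⊔ Ideal.span {f}).radical) : IsRegularMod I f := by
  intro u hu
  obtain ⟨n, hn⟩ := h
  obtain ⟨i, hi, b, hb, hib⟩ := Submodule.mem_sup.1 hn
  obtain ⟨v, rfl⟩ := Ideal.mem_span_singleton'.1 hb
  refine hl.pow n u ?_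
  have : l ^ n * u = i * u + v * (f * u) := by rw [← hib]; ring
  rw [this]
  exact add_mem (Ideal.mul_mem_right _ _ hi) (Ideal.mul_mem_left _ _ hu)

/-- Every member of the list is regular modulo `I` and the later members. -/
def IsRegularListMod (I : Ideal A) : List A → Prop
  | [] => True
  | f :: gs => IsRegularMod (I ⊔ Ideal.ofList gs) f ∧ IsRegularListMod I gs

lemma IsRegularListMod.swap {I : Ideal A} {l : A} (hl : IsRegularMod I l) {gs : List A}
    (hgs : IsRegularListMod (I ⊔ Ideal.span {l}) gs) : IsRegularMod (I ⊔ Ideal.ofList gs) l := by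
  induction gs with
  | nil => simpa using hl
  | cons f gs ih =>
    rw [Ideal.ofList_cons, sup_comm (Ideal.span {f}), ← sup_assoc]
    refine (ih hgs.2).swap ?_
    rw [sup_right_comm]
    exact hgs.1

end Regular

section GradedRegular

variable {σ K : Type*} [Field K]

lemma IsRegularMod.of_sup_span_singleton {I : Ideal (MvPolynomial σ K)} (hI : IsHomogeneousIdeal I)
    {l f : MvPolynomial σ K} {e : ℕ} (hlh : l.IsHomogeneous 1) (hfh : f.IsHomogeneous e)
    (hl : IsRegularMod I l) (hf : IsRegularMod (I ⊔ Ideal.span {l}) f) : IsRegularMod I f := by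
  have key : ∀ d, ∀ u : MvPolynomial σ K, u.IsHomogeneous d → f * u ∈ I → u ∈ I := by
    intro d
    induction d with
    | zero =>
      intro u hu h
      obtain ⟨i, hi, b, hb, rfl⟩ := Submodule.mem_sup.1 (hf u (Ideal.mem_sup_left h))
      obtain ⟨v, rfl⟩ := Ideal.mem_span_singleton'.1 hb
      rw [← homogeneousComponent_eq_self hu, map_add, mul_comm,
        homogeneousComponent_mul_of_lt hlh _ zero_lt_one, add_zero]
      exact hI i hi 0
    | succ d ih =>
      intro u hu h
      obtain ⟨i, hi, b, hb, hib⟩ := Submodule.mem_sup.1 (hf u (Ideal.mem_sup_left h))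
      obtain ⟨v, rfl⟩ := Ideal.mem_span_singleton'.1 hb
      have hu' : u = homogeneousComponent (d + 1) i + l * homogeneousComponent d v := by
        rw [← homogeneousComponent_mul_of_isHomogeneous hlh, mul_comm l, ← map_add, hib,
          homogeneousComponent_eq_self hu]
      have hi' := hI i hi (d + 1)
      have hv : f * homogeneousComponent d v ∈ I := by
        refine hl _ ?_
        have : l * (f * homogeneousComponent d v) =
            f * u - f * homogeneousComponent (d + 1) i := by
          linear_combination -f * hu'
        rw [this]
        exact sub_mem h (Ideal.mul_mem_left _ _ hi')
      rw [hu']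
      exact add_mem hi' (Ideal.mul_mem_left _ _
        (ih _ (homogeneousComponent_isHomogeneous d v) hv))
  intro u hu
  refine IsHomogeneousIdeal.mem_of_homogeneousComponent fun d =>
    key d _ (homogeneousComponent_isHomogeneous d u) ?_
  rw [← homogeneousComponent_mul_of_isHomogeneous hfh]
  exact hI _ hu _

lemma isHomogeneousIdeal_ofList {gs : List (MvPolynomial σ K)} {e : ℕ}
    (hgs : ∀ g ∈ gs, g.IsHomogeneous e) : IsHomogeneousIdeal (Ideal.ofList gs) :=
  isHomogeneousIdeal_span fun f hf => ⟨e, hgs f hf⟩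

lemma IsRegularListMod.of_sup_span_singleton {I : Ideal (MvPolynomial σ K)}
    (hI : IsHomogeneousIdeal I) {l : MvPolynomial σ K} {e : ℕ} (hlh : l.IsHomogeneous 1)
    (hl : IsRegularMod I l) {gs : List (MvPolynomial σ K)} (hgsh : ∀ g ∈ gs, g.IsHomogeneous e)
    (hgs : IsRegularListMod (I ⊔ Ideal.span {l}) gs) : IsRegularListMod I gs := by
  induction gs with
  | nil => trivial
  | cons f gs ih =>
    have hgsh' : ∀ g ∈ gs, g.IsHomogeneous e := fun g hg => hgsh g (by simp [hg])
    refine ⟨IsRegularMod.of_sup_span_singleton (hI.sup (isHomogeneousIdeal_ofList hgsh'))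
      hlh (hgsh f (by simp)) (hgs.2.swap hl) ?_, ih hgsh' hgs.2⟩
    rw [sup_right_comm]
    exact hgs.1

/-- The socle of the quotient by `I` is at most one-dimensional and lives in degree `D`. -/
def HasSocleInDegree (I : Ideal (MvPolynomial σ K)) (D : ℕ) : Prop :=
  (∀ d, d ≠ D → ∀ u : MvPolynomial σ K, u.IsHomogeneous d → (∀ i, X i * u ∈ I) → u ∈ I) ∧
  ∀ u v : MvPolynomial σ K, u.IsHomogeneous D → v.IsHomogeneous D →
    (∀ i, X i * u ∈ I) → (∀ i, X i * v ∈ I) →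
    ∃ a b : K, (a ≠ 0 ∨ b ≠ 0) ∧ C a * u + C b * v ∈ I

lemma exists_socle_exchange {I : Ideal (MvPolynomial σ K)} (hI : IsHomogeneousIdeal I)
    {l f : MvPolynomial σ K} (hlh : l.IsHomogeneous 1) (hfh : f.IsHomogeneous 2)
    (hf : IsRegularMod I f) {d : ℕ} {u : MvPolynomial σ K}
    (hu : u.IsHomogeneous (d + 1)) (hsoc : ∀ i, X i * u ∈ I ⊔ Ideal.span {f}) :
    ∃ v : MvPolynomial σ K, v.IsHomogeneous d ∧ l * u - f * v ∈ I ∧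
      ∀ i, X i * v ∈ I ⊔ Ideal.span {l} := by
  obtain ⟨i, hi, b, hb, hib⟩ := Submodule.mem_sup.1
    (mul_mem_of_forall_X hsoc (mem_idealOfVars hlh le_rfl))
  obtain ⟨v, rfl⟩ := Ideal.mem_span_singleton'.1 hb
  have hlu : (l * u).IsHomogeneous (d + 2) := by
    have := hlh.mul hu
    rwa [show 1 + (d + 1) = d + 2 by ring] at this
  have h : l * u - f * homogeneousComponent d v ∈ I := by
    rw [← homogeneousComponent_mul_of_isHomogeneous hfh, ← homogeneousComponent_eq_self hlu,
      ← map_sub, ← hib, mul_comm f, add_sub_cancel_right]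
    exact hI i hi _
  refine ⟨_, homogeneousComponent_isHomogeneous d v, h, fun k => ?_⟩
  obtain ⟨j, hj, c, hc, hjc⟩ := Submodule.mem_sup.1 (hsoc k)
  obtain ⟨w, rfl⟩ := Ideal.mem_span_singleton'.1 hc
  have : X k * homogeneousComponent d v - w * l ∈ I := by
    refine hf _ ?_
    have e : f * (X k * homogeneousComponent d v - w * l) =
        l * j - X k * (l * u - f * homogeneousComponent d v) := by
      linear_combination -l * hjc
    rw [e]
    exact sub_mem (Ideal.mul_mem_left _ _ hj) (Ideal.mul_mem_left _ _ h)
  exact Submodule.mem_sup.2 ⟨_, this, w * l, Ideal.mem_span_singleton'.2 ⟨w, rfl⟩, by ring⟩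

lemma mem_of_socle_exchange {I : Ideal (MvPolynomial σ K)} {l f u v : MvPolynomial σ K}
    (hl : IsRegularMod I l) (h : l * u - f * v ∈ I) (hv : v ∈ I ⊔ Ideal.span {l}) :
    u ∈ I ⊔ Ideal.span {f} := by
  obtain ⟨j, hj, c, hc, rfl⟩ := Submodule.mem_sup.1 hv
  obtain ⟨w, rfl⟩ := Ideal.mem_span_singleton'.1 hc
  have : u - w * f ∈ I := by
    refine hl _ ?_
    have e : l * (u - w * f) = (l * u - f * (j + w * l)) + f * j := by ring
    rw [e]
    exact add_mem h (Ideal.mul_mem_left _ _ hj)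
  exact Submodule.mem_sup.2 ⟨_, this, w * f, Ideal.mem_span_singleton'.2 ⟨w, rfl⟩, by ring⟩

lemma HasSocleInDegree.exchange {I : Ideal (MvPolynomial σ K)} (hI : IsHomogeneousIdeal I)
    {l f : MvPolynomial σ K} (hlh : l.IsHomogeneous 1) (hfh : f.IsHomogeneous 2)
    (hl : IsRegularMod I l) (hf : IsRegularMod I f) {D : ℕ}
    (h : HasSocleInDegree (I ⊔ Ideal.span {l}) D) :
    HasSocleInDegree (I ⊔ Ideal.span {f}) (D + 1) := by
  constructor
  · rintro (_ | d) hd u hu hsoc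
    · obtain ⟨i, hi, b, hb, hib⟩ := Submodule.mem_sup.1
        (mul_mem_of_forall_X hsoc (mem_idealOfVars hlh le_rfl))
      obtain ⟨v, rfl⟩ := Ideal.mem_span_singleton'.1 hb
      refine Ideal.mem_sup_left (hl u ?_)
      rw [← homogeneousComponent_eq_self (hlh.mul hu), ← hib, map_add, mul_comm v,
        homogeneousComponent_mul_of_lt hfh _ (by norm_num), add_zero]
      exact hI i hi _
    · obtain ⟨v, hv, huv, hvs⟩ := exists_socle_exchange hI hlh hfh hf hu hsoc
      exact mem_of_socle_exchange hl huv (h.1 d (by omega) v hv hvs)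
  · intro u₁ u₂ hu₁ hu₂ hs₁ hs₂
    obtain ⟨v₁, hv₁, huv₁, hvs₁⟩ := exists_socle_exchange hI hlh hfh hf hu₁ hs₁
    obtain ⟨v₂, hv₂, huv₂, hvs₂⟩ := exists_socle_exchange hI hlh hfh hf hu₂ hs₂
    obtain ⟨a, b, hab, hv⟩ := h.2 v₁ v₂ hv₁ hv₂ hvs₁ hvs₂
    refine ⟨a, b, hab, mem_of_socle_exchange hl ?_ hv⟩
    have e : l * (C a * u₁ + C b * u₂) - f * (C a * v₁ + C b * v₂) =
        C a * (l * u₁ - f * v₁) + C b * (l * u₂ - f * v₂) := by ring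
    rw [e]
    exact add_mem (Ideal.mul_mem_left _ _ huv₁) (Ideal.mul_mem_left _ _ huv₂)

lemma hasSocleInDegree_idealOfVars : HasSocleInDegree (idealOfVars σ K) 0 := by
  constructor
  · intro d hd u hu _
    exact mem_idealOfVars hu (by omega)
  · intro u v hu hv _ _
    rw [← homogeneousComponent_eq_self hu, ← homogeneousComponent_eq_self hv]
    simp only [homogeneousComponent_zero]
    by_cases h : coeff 0 u = 0
    · exact ⟨1, 0, by simp, by simp [h]⟩
    · refine ⟨-coeff 0 v, coeff 0 u, Or.inr h, ?_⟩
      have : C (-coeff 0 v) * C (coeff 0 u) + C (coeff 0 u) * C (coeff 0 v) =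
          (0 : MvPolynomial σ K) := by rw [C_neg]; ring
      rw [this]
      exact zero_mem _

end GradedRegular

end MvPolynomial

namespace MvPolynomial

section LinearForms

variable {σ K : Type*} [Field K]

/-- A linear form outside a space `U` of linear forms is regular modulo the ideal generated by
`U`. -/
lemma isRegularMod_span_linearForms {U : Submodule K (MvPolynomial σ K)}
    (hU : U ≤ homogeneousSubmodule σ K 1) {l : MvPolynomial σ K} (hl : l.IsHomogeneous 1)
    (hlU : l ∉ U) : IsRegularMod (Ideal.span (U : Set (MvPolynomial σ K))) l := by
  obtain ⟨V, hV⟩ := U.exists_isCompl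
  let P : MvPolynomial σ K →ₗ[K] MvPolynomial σ K := V.subtype ∘ₗ V.projectionOnto U hV.symm
  have hP : ∀ x, P x = 0 ↔ x ∈ U := by
    intro x
    simp [P]
  have hPs : ∀ x, x - P x ∈ U := by
    intro x
    rw [← hP, map_sub]
    have := V.projectionOnto_apply_left hV.symm (V.projectionOnto U hV.symm x)
    simp only [P, LinearMap.comp_apply, Submodule.subtype_apply, this, sub_self]
  let φ : MvPolynomial σ K →ₐ[K] MvPolynomial σ K := aeval fun i => P (X i)
  have hφ : ∀ x ∈ homogeneousSubmodule σ K 1, φ x = P x := by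
    have : homogeneousSubmodule σ K 1 ≤ LinearMap.eqLocus φ.toLinearMap P := by
      rw [homogeneousSubmodule_one_eq_span_X, Submodule.span_le]
      rintro _ ⟨i, rfl⟩
      simp [φ]
    exact fun x hx => this hx
  have hmem : ∀ p, p - φ p ∈ Ideal.span (U : Set (MvPolynomial σ K)) := by
    intro p
    induction p using MvPolynomial.induction_on with
    | C a => simp [φ]
    | add p q hp hq =>
      have e : p + q - φ (p + q) = (p - φ p) + (q - φ q) := by rw [map_add]; ring
      rw [e]
      exact add_mem hp hq
    | mul_X p i hp =>
      have e : p * X i - φ (p * X i) = (p - φ p) * X i + φ p * (X i - P (X i)) := by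
        rw [map_mul]
        simp only [φ, aeval_X]
        ring
      rw [e]
      exact add_mem (Ideal.mul_mem_right _ _ hp)
        (Ideal.mul_mem_left _ _ (Ideal.subset_span (hPs _)))
  have hker : Ideal.span (U : Set (MvPolynomial σ K)) = RingHom.ker φ := by
    refine le_antisymm (Ideal.span_le.2 fun x hx => ?_) fun p hp => ?_
    · rw [SetLike.mem_coe, RingHom.mem_ker, hφ x (hU hx), (hP x).2 hx]
    · simpa [(RingHom.mem_ker).1 hp] using hmem p
  intro u hu
  rw [hker, RingHom.mem_ker, map_mul, mul_eq_zero] at hu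
  rw [hker, RingHom.mem_ker]
  exact hu.resolve_left fun h => hlU ((hP l).1 (by rw [← hφ l hl, h]))

end LinearForms

section Generic

variable {σ K : Type*} [Field K]

lemma eval_smul_eq_sum_homogeneousComponent (p : MvPolynomial σ K) (x : σ → K) (c : K) :
    eval (c • x) p = ∑ i ∈ Finset.range (p.totalDegree + 1),
      c ^ i * eval x (homogeneousComponent i p) := by
  conv_lhs => rw [← sum_homogeneousComponent p, map_sum]
  refine Finset.sum_congr rfl fun i _ => ?_
  have hi := homogeneousComponent_isHomogeneous i p
  rw [eval_eq, eval_eq, Finset.mul_sum]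
  refine Finset.sum_congr rfl fun d hd => ?_
  simp only [Pi.smul_apply, smul_eq_mul, mul_pow, Finset.prod_mul_distrib,
    Finset.prod_pow_eq_pow_sum]
  rw [← hi.degree_eq_sum_deg_support hd]
  ring

/-- The restriction of polynomials to the line through the origin and `x`. -/
def restrictToLine (x : σ → K) : MvPolynomial σ K →ₐ[K] Polynomial K :=
  aeval fun i => Polynomial.C (x i) * Polynomial.X

lemma eval_restrictToLine (x : σ → K) (p : MvPolynomial σ K) (c : K) :
    (restrictToLine x p).eval c = eval (c • x) p := by
  induction p using MvPolynomial.induction_on with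
  | C a => simp [restrictToLine]
  | add p q hp hq => simp [hp, hq]
  | mul_X p i hp =>
    rw [map_mul, Polynomial.eval_mul, hp, restrictToLine, aeval_X]
    simp [mul_comm c]

lemma IsHomogeneousIdeal.le_ker_restrictToLine [Infinite K] {I : Ideal (MvPolynomial σ K)}
    (hI : IsHomogeneousIdeal I) {x : σ → K} (hx : ∀ p ∈ I, eval x p = 0) :
    I ≤ RingHom.ker (restrictToLine x) := by
  intro p hp
  rw [RingHom.mem_ker]
  refine Polynomial.funext fun c => ?_
  rw [eval_restrictToLine, eval_smul_eq_sum_homogeneousComponent, Polynomial.eval_zero]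
  exact Finset.sum_eq_zero fun i _ => by rw [hx _ (hI p hp i), mul_zero]

lemma mem_idealOfVars_of_eval_zero {p : MvPolynomial σ K} (hp : eval 0 p = 0) :
    p ∈ idealOfVars σ K := by
  have := (mem_pow_idealOfVars_iff' 1 p).2 fun x hx => by
    have hx0 : x = 0 := (Finsupp.degree_eq_zero_iff x).1 (Nat.lt_one_iff.1 hx)
    rw [hx0, ← hp]
    simp [constantCoeff_eq]
  simpa using this

lemma isMaximal_idealOfVars : (idealOfVars σ K).IsMaximal := by
  have : idealOfVars σ K = RingHom.ker (eval (0 : σ → K)) := by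
    refine le_antisymm (Ideal.span_le.2 ?_) fun p hp => mem_idealOfVars_of_eval_zero hp
    rintro _ ⟨i, rfl⟩
    simp
  rw [this]
  exact RingHom.ker_isMaximal_of_surjective _ fun c => ⟨C c, by simp⟩

variable [IsAlgClosed K] [Finite σ]

lemma idealOfVars_le_radical {I : Ideal (MvPolynomial σ K)}
    (h : ∀ x : σ → K, (∀ p ∈ I, eval x p = 0) → x = 0) : idealOfVars σ K ≤ I.radical := by
  rw [← vanishingIdeal_zeroLocus_eq_radical (K := K), idealOfVars, Ideal.span_le]
  rintro _ ⟨i, rfl⟩ x hx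
  have := h x fun p hp => by simpa using hx p hp
  simp [this]

lemma exists_linearForm {I : Ideal (MvPolynomial σ K)} (hI : IsHomogeneousIdeal I)
    {f : MvPolynomial σ K} (hf : f ∈ idealOfVars σ K)
    (hIf : idealOfVars σ K ≤ (I ⊔ Ideal.span {f}).radical)
    {U : Submodule K (MvPolynomial σ K)} (hU : U < homogeneousSubmodule σ K 1) :
    ∃ l : MvPolynomial σ K, l.IsHomogeneous 1 ∧ l ∉ U ∧
      idealOfVars σ K ≤ (I ⊔ Ideal.span {l}).radical := by
  classical
  have hmax : (idealOfVars σ K).IsMaximal := isMaximal_idealOfVars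
  let T : Set (Submodule K (MvPolynomial σ K)) := insert U
    ((fun p : Ideal (MvPolynomial σ K) => p.restrictScalars K) ''
      (I.minimalPrimes \ {idealOfVars σ K}))
  have hT : T.Finite :=
    ((Ideal.finite_minimalPrimes_of_isNoetherianRing _ I).sdiff.image _).insert U
  have hTne : ∀ V ∈ T, ¬ homogeneousSubmodule σ K 1 ≤ V := by
    rintro V (rfl | ⟨p, ⟨hp, hpm⟩, rfl⟩) hV
    · exact hU.not_ge hV
    · refine hpm (hmax.eq_of_le hp.1.1.ne_top ?_).symm
      rw [idealOfVars, Ideal.span_le]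
      rintro _ ⟨i, rfl⟩
      exact hV (isHomogeneous_X K i)
  obtain ⟨l, hl⟩ : ∃ l : homogeneousSubmodule σ K 1, ∀ V ∈ T, (l : MvPolynomial σ K) ∉ V := by
    by_contra! hcov
    have := Subspace.top_mem_of_biUnion_eq_univ
      (s := hT.toFinset.image fun V => V.comap (homogeneousSubmodule σ K 1).subtype) (by
        refine Set.eq_univ_of_forall fun l => ?_
        obtain ⟨V, hV, hlV⟩ := hcov l
        simp only [Finset.mem_image, Set.Finite.mem_toFinset, Set.mem_iUnion]
        exact ⟨_, ⟨V, hV, rfl⟩, hlV⟩)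
    obtain ⟨V, hV, hVt⟩ := Finset.mem_image.1 this
    exact hTne V (hT.mem_toFinset.1 hV) (Submodule.comap_subtype_eq_top.1 hVt)
  refine ⟨l, l.2, hl U (Set.mem_insert _ _), idealOfVars_le_radical fun x hx => ?_⟩
  by_contra hx0
  obtain ⟨i, hi⟩ := Function.ne_iff.1 hx0
  let q := RingHom.ker (restrictToLine x)
  have hqp : q.IsPrime := RingHom.ker_isPrime _
  have hq : I ⊔ Ideal.span {(l : MvPolynomial σ K)} ≤ q :=
    (hI.sup (isHomogeneousIdeal_span_singleton l.2)).le_ker_restrictToLine hx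
  have hXq : X i ∉ q := by
    intro h
    have := congrArg (Polynomial.eval 1) ((RingHom.mem_ker).1 h)
    rw [eval_restrictToLine] at this
    exact hi (by simpa using this)
  have hqm : q < idealOfVars σ K := by
    refine lt_of_le_of_ne (fun p hp => ?_) fun h =>
      hXq (h ▸ Ideal.subset_span (Set.mem_range_self i))
    have := congrArg (Polynomial.eval 0) ((RingHom.mem_ker).1 hp)
    rw [eval_restrictToLine, zero_smul, Polynomial.eval_zero] at this
    exact mem_idealOfVars_of_eval_zero this
  obtain ⟨p, hp, hpq⟩ := Ideal.exists_minimalPrimes_le (le_sup_left.trans hq)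
  have hpp : p.IsPrime := hp.1.1
  have hpm : p ≠ idealOfVars σ K := fun h => hqm.not_ge (h ▸ hpq)
  have hlp : (l : MvPolynomial σ K) ∉ p :=
    hl _ (Set.mem_insert_of_mem _ ⟨p, ⟨hp, hpm⟩, rfl⟩)
  have hpq' : p < q := lt_of_le_of_ne hpq fun h =>
    hlp (h ▸ hq (Ideal.mem_sup_right (Ideal.mem_span_singleton_self _)))
  have hmin : idealOfVars σ K ∈ (p ⊔ Ideal.span {f}).minimalPrimes := by
    refine ⟨⟨hmax.isPrime, sup_le (hpq.trans hqm.le) ?_⟩, fun r hr _ => ?_⟩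
    · rwa [Ideal.span_singleton_le_iff_mem]
    · refine hIf.trans (hr.1.radical_le_iff.2 (le_trans ?_ hr.2))
      exact sup_le_sup_right hp.1.2 _
  have hheight := Ideal.map_height_le_one_of_mem_minimalPrimes hmin
  have hcomap : ∀ r : Ideal (MvPolynomial σ K), p ≤ r →
      (r.map (Ideal.Quotient.mk p)).comap (Ideal.Quotient.mk p) = r := fun r hr => by
    rw [Ideal.comap_map_of_surjective' _ Ideal.Quotient.mk_surjective, Ideal.mk_ker,
      sup_eq_left.2 hr]
  have hmono : ∀ r s : Ideal (MvPolynomial σ K), p ≤ r → r < s →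
      r.map (Ideal.Quotient.mk p) < s.map (Ideal.Quotient.mk p) := fun r s hr hrs => by
    refine lt_of_le_of_ne (Ideal.map_mono hrs.le) fun h => hrs.ne ?_
    rw [← hcomap r hr, ← hcomap s (hr.trans hrs.le), h]
  have hprime : ∀ r : Ideal (MvPolynomial σ K), p ≤ r → r.IsPrime →
      (r.map (Ideal.Quotient.mk p)).IsPrime := fun r hr _ =>
    Ideal.map_isPrime_of_surjective Ideal.Quotient.mk_surjective (by rwa [Ideal.mk_ker])
  have h₀ := hprime p le_rfl hpp
  have h₁ := hprime q hpq hqp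
  have h₂ := hprime _ (hpq.trans hqm.le) hmax.isPrime
  have l₁ := Ideal.height_strict_mono_of_isPrime_of_isPrime (hmono p q le_rfl hpq')
  have l₂ := Ideal.height_strict_mono_of_isPrime_of_isPrime (hmono q _ hpq hqm)
  have l₃ := l₂.trans_le hheight
  rw [Order.lt_one_iff] at l₃
  rw [l₃] at l₁
  exact not_lt_zero l₁

end Generic

end MvPolynomial

namespace MvPolynomial

section SocleDegree

variable {σ K : Type*} [Field K]

lemma span_sup_span_singleton (U : Submodule K (MvPolynomial σ K)) (l : MvPolynomial σ K) :
    Ideal.span ((U ⊔ Submodule.span K {l} : Submodule K (MvPolynomial σ K)) :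
      Set (MvPolynomial σ K)) = Ideal.span (U : Set (MvPolynomial σ K)) ⊔ Ideal.span {l} := by
  refine le_antisymm (Ideal.span_le.2 fun x hx => ?_) (sup_le (Ideal.span_mono ?_) ?_)
  · obtain ⟨a, ha, b, hb, rfl⟩ := Submodule.mem_sup.1 hx
    obtain ⟨c, rfl⟩ := Submodule.mem_span_singleton.1 hb
    refine Submodule.add_mem_sup (Ideal.subset_span ha) ?_
    rw [smul_eq_C_mul]
    exact Ideal.mul_mem_left _ _ (Ideal.mem_span_singleton_self l)
  · exact fun x hx => Submodule.mem_sup_left hx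
  · rw [Ideal.span_singleton_le_iff_mem]
    exact Ideal.subset_span (Submodule.mem_sup_right (Submodule.mem_span_singleton_self l))

instance finiteDimensional_homogeneousSubmodule [Finite σ] (n : ℕ) :
    FiniteDimensional K (homogeneousSubmodule σ K n) :=
  Module.Finite.iff_fg.2 (homogeneousSubmodule_fg σ K n)

lemma finrank_sup_span_singleton_of_notMem {V : Type*} [AddCommGroup V] [Module K V]
    {U : Submodule K V} [FiniteDimensional K U] {l : V} (hl : l ∉ U) :
    Module.finrank K (U ⊔ Submodule.span K {l} : Submodule K V) = Module.finrank K U + 1 := by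
  have h := Submodule.finrank_sup_add_finrank_inf_eq U (Submodule.span K {l})
  have hl0 : l ≠ 0 := fun h => hl (h ▸ zero_mem U)
  rwa [finrank_span_singleton hl0, (Submodule.disjoint_span_singleton_of_notMem hl).eq_bot,
    finrank_bot] at h

theorem isRegularListMod_and_hasSocleInDegree [IsAlgClosed K] [Finite σ]
    {fs : List (MvPolynomial σ K)} (hfs : ∀ f ∈ fs, f.IsHomogeneous 2)
    {U : Submodule K (MvPolynomial σ K)} (hU : U ≤ homogeneousSubmodule σ K 1)
    (hdim : Module.finrank K U + fs.length = Module.finrank K (homogeneousSubmodule σ K 1))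
    (hrad : idealOfVars σ K ≤
      (Ideal.span (U : Set (MvPolynomial σ K)) ⊔ Ideal.ofList fs).radical) :
    IsRegularListMod (Ideal.span (U : Set (MvPolynomial σ K))) fs ∧
      HasSocleInDegree (Ideal.span (U : Set (MvPolynomial σ K)) ⊔ Ideal.ofList fs) fs.length := by
  induction fs generalizing U with
  | nil =>
    have hUeq : U = homogeneousSubmodule σ K 1 :=
      Submodule.eq_of_le_of_finrank_eq hU (by simpa using hdim)
    have : Ideal.span (U : Set (MvPolynomial σ K)) = idealOfVars σ K := by
      refine le_antisymm (Ideal.span_le.2 fun x hx => mem_idealOfVars (hU hx) le_rfl)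
        (Ideal.span_mono ?_)
      rintro _ ⟨i, rfl⟩
      rw [hUeq]
      exact isHomogeneous_X K i
    refine ⟨trivial, ?_⟩
    rw [this, Ideal.ofList_nil, sup_bot_eq]
    exact hasSocleInDegree_idealOfVars
  | cons f gs ih =>
    have hgs : ∀ g ∈ gs, g.IsHomogeneous 2 := fun g hg => hfs g (by simp [hg])
    have hf : f.IsHomogeneous 2 := hfs f (by simp)
    have hUh : IsHomogeneousIdeal (Ideal.span (U : Set (MvPolynomial σ K))) :=
      isHomogeneousIdeal_span fun x hx => ⟨1, hU hx⟩
    have hIh := hUh.sup (isHomogeneousIdeal_ofList hgs)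
    have hUlt : U < homogeneousSubmodule σ K 1 := by
      refine lt_of_le_of_ne hU fun h => ?_
      rw [h, List.length_cons] at hdim
      omega
    rw [Ideal.ofList_cons, sup_comm (Ideal.span {f}), ← sup_assoc] at hrad ⊢
    obtain ⟨l, hlh, hlU, hl⟩ :=
      exists_linearForm hIh (mem_idealOfVars hf one_le_two) hrad hUlt
    have hU' : U ⊔ Submodule.span K {l} ≤ homogeneousSubmodule σ K 1 :=
      sup_le hU ((Submodule.span_singleton_le_iff_mem _ _).2 hlh)
    have : FiniteDimensional K U := Submodule.finiteDimensional_of_le hU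
    have hfin := finrank_sup_span_singleton_of_notMem hlU
    have hspan := span_sup_span_singleton U l
    rw [sup_right_comm, ← hspan] at hl
    obtain ⟨hreg, hsoc⟩ := ih hgs hU' (by rw [hfin, ← hdim, List.length_cons]; omega) hl
    rw [hspan] at hreg hsoc
    have hlU' := isRegularMod_span_linearForms hU hlh hlU
    have hlreg := hreg.swap hlU'
    have hfreg : IsRegularMod (Ideal.span (U : Set (MvPolynomial σ K)) ⊔ Ideal.ofList gs) f :=
      hlreg.of_mem_radical (hrad (mem_idealOfVars hlh le_rfl))
    rw [sup_right_comm] at hsoc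
    exact ⟨⟨hfreg, hreg.of_sup_span_singleton hUh hlh hlU' hgs⟩,
      hsoc.exchange hIh hlh hf hlreg hfreg⟩

lemma HasSocleInDegree.exists_mul_notMem {I : Ideal (MvPolynomial σ K)} [Finite σ] {D : ℕ}
    (h : HasSocleInDegree I D) (hI : idealOfVars σ K ≤ I.radical) {d : ℕ} {u : MvPolynomial σ K}
    (hu : u.IsHomogeneous d) (huI : u ∉ I) :
    ∃ e, ∃ v : MvPolynomial σ K, d + e = D ∧ v.IsHomogeneous e ∧ v * u ∉ I := by
  obtain ⟨N, hN⟩ := Ideal.exists_pow_le_of_le_radical_of_fg hI (idealOfVars_fg σ K)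
  induction hk : N - d generalizing d u with
  | zero => exact absurd (hN (mem_idealOfVars_pow hu (by omega))) huI
  | succ k ih =>
    by_cases hd : d = D
    · exact ⟨0, 1, hd, isHomogeneous_one σ K, by simpa using huI⟩
    · have : ∃ i, X i * u ∉ I := by
        by_contra! hX
        exact huI (h.1 d hd u hu hX)
      obtain ⟨i, hi⟩ := this
      have hXu : (X i * u).IsHomogeneous (d + 1) := by
        rw [add_comm]
        exact (isHomogeneous_X K i).mul hu
      obtain ⟨e, v, he, hv, hvu⟩ := ih hXu hi (by omega)
      refine ⟨e + 1, v * X i, by omega, hv.mul (isHomogeneous_X K i), ?_⟩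
      rwa [mul_assoc]

end SocleDegree

section Count

variable {σ K : Type*} [Field K]

lemma finrank_homogeneousSubmodule [Fintype σ] (n : ℕ) :
    Module.finrank K (homogeneousSubmodule σ K n) = (Fintype.card σ + n - 1).choose n := by
  classical
  rw [homogeneousSubmodule_eq_finsupp_supported,
    (AddMonoidAlgebra.supportedEquivFinsupp {d : σ →₀ ℕ | d.degree = n}).finrank_eq]
  have : {d : σ →₀ ℕ | d.degree = n} = ((Finset.univ : Finset σ).finsuppAntidiag n : Set _) := by
    ext d
    simp [Finset.mem_finsuppAntidiag, Finsupp.degree_eq_sum]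
  rw [this, Module.finrank_finsupp_self]
  simp [Finset.card_finsuppAntidiag_nat_eq_choose]

end Count

end MvPolynomial

namespace MvPolynomial

section Duality

variable {σ K : Type*} [Field K] [Finite σ]

lemma HasSocleInDegree.exists_dual {I : Ideal (MvPolynomial σ K)} {D : ℕ}
    (h : HasSocleInDegree I D) (hI : idealOfVars σ K ≤ I.radical) :
    ∃ g : MvPolynomial σ K →ₗ[K] K,
      ∀ p : MvPolynomial σ K, p.IsHomogeneous D → (g p = 0 ↔ p ∈ I) := by
  by_cases hw : ∃ w : MvPolynomial σ K, w.IsHomogeneous D ∧ w ∉ I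
  · obtain ⟨w, hw, hwI⟩ := hw
    obtain ⟨g, hgw, hgI⟩ :=
      Submodule.exists_le_ker_of_notMem (p := I.restrictScalars K) (v := w) hwI
    refine ⟨g, fun p hp => ⟨fun hgp => ?_, fun hpI => hgI hpI⟩⟩
    have hX : ∀ q : MvPolynomial σ K, q.IsHomogeneous D → ∀ i, X i * q ∈ I := by
      intro q hq i
      by_contra hqI
      obtain ⟨e, -, he, -⟩ := h.exists_mul_notMem hI ((isHomogeneous_X K i).mul hq) hqI
      omega
    obtain ⟨a, b, hab, hmem⟩ := h.2 p w hp hw (hX p hp) (hX w hw)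
    have h0 : g (C a * p + C b * w) = 0 := hgI hmem
    rw [← smul_eq_C_mul, ← smul_eq_C_mul, map_add, map_smul, map_smul, hgp, smul_zero, zero_add,
      smul_eq_zero] at h0
    have hb : b = 0 := h0.resolve_right hgw
    have ha : a ≠ 0 := hab.resolve_right (not_not.2 hb)
    rw [hb, C_0, zero_mul, add_zero] at hmem
    have := Ideal.mul_mem_left _ (C a⁻¹) hmem
    rwa [← mul_assoc, ← C_mul, inv_mul_cancel₀ ha, C_1, one_mul] at this
  · push Not at hw
    exact ⟨0, fun p hp => by simpa using hw p hp⟩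

lemma HasSocleInDegree.exists_annihilator {I : Ideal (MvPolynomial σ K)} {a b : ℕ}
    (h : HasSocleInDegree I (a + b)) (hI : idealOfVars σ K ≤ I.radical)
    {N : Submodule K (homogeneousSubmodule σ K b)} (hN : N ≠ ⊤)
    (hIN : ∀ x : homogeneousSubmodule σ K b, (x : MvPolynomial σ K) ∈ I → x ∈ N) :
    ∃ ξ : MvPolynomial σ K, ξ.IsHomogeneous a ∧ ξ ∉ I ∧
      ∀ x ∈ N, ξ * (x : MvPolynomial σ K) ∈ I := by
  obtain ⟨g, hg⟩ := h.exists_dual hI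
  let Φ : homogeneousSubmodule σ K a →ₗ[K] Module.Dual K (homogeneousSubmodule σ K b) :=
    ((LinearMap.mul K (MvPolynomial σ K)).compr₂ g).domRestrict₁₂ _ _
  have hΦ : ∀ x y, Φ x y = g ((x : MvPolynomial σ K) * y) := fun _ _ => rfl
  have hle : Φ.range.dualCoannihilator ≤ N := by
    intro x hx
    refine hIN x ?_
    by_contra hxI
    obtain ⟨e, v, he, hv, hvx⟩ := h.exists_mul_notMem hI x.2 hxI
    obtain rfl : e = a := by omega
    refine hvx ((hg _ (hv.mul x.2)).1 ?_)
    exact (Submodule.mem_dualCoannihilator x).1 hx _ ⟨⟨v, hv⟩, rfl⟩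
  obtain ⟨ψ, hψ, hψN⟩ : ∃ ψ ∈ N.dualAnnihilator, ψ ≠ 0 := by
    rw [← Submodule.ne_bot_iff]
    exact fun hbot => hN (Subspace.dualAnnihilator_inj.1
      (hbot.trans Submodule.dualAnnihilator_top.symm))
  have hψ' : ψ ∈ Φ.range := by
    rw [← Subspace.dualCoannihilator_dualAnnihilator_eq (W := Φ.range)]
    exact Submodule.dualAnnihilator_anti hle hψ
  obtain ⟨ξ, rfl⟩ := hψ'
  refine ⟨ξ, ξ.2, fun hξ => hψN ?_, fun x hx => ?_⟩
  · ext x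
    exact (hg _ (ξ.2.mul x.2)).2 (Ideal.mul_mem_right _ _ hξ)
  · exact (hg _ (ξ.2.mul x.2)).1 ((Submodule.mem_dualAnnihilator _).1 hψ x hx)

end Duality

section Generators

variable {σ K : Type*} [Field K]

lemma homogeneousComponent_mem_span {s : Set (MvPolynomial σ K)} {e : ℕ}
    (hs : ∀ f ∈ s, f.IsHomogeneous e) {p : MvPolynomial σ K} (hp : p ∈ Ideal.span s) :
    homogeneousComponent e p ∈ Submodule.span K s := by
  induction hp using Submodule.closure_induction with
  | zero => simp
  | add p q _ _ hp hq => rw [map_add]; exact add_mem hp hq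
  | smul_mem a f hf =>
    have := homogeneousComponent_mul_of_isHomogeneous (hs f hf) a 0
    rw [zero_add, homogeneousComponent_zero, mul_comm f, mul_comm f, ← smul_eq_C_mul] at this
    rw [smul_eq_mul, this]
    exact Submodule.smul_mem _ _ (Submodule.subset_span hf)

lemma restrictScalars_span_inf_homogeneousSubmodule {s : Set (MvPolynomial σ K)} {e : ℕ}
    (hs : ∀ f ∈ s, f.IsHomogeneous e) :
    (Ideal.span s).restrictScalars K ⊓ homogeneousSubmodule σ K e = Submodule.span K s := by
  refine le_antisymm (fun p hp => ?_) (Submodule.span_le.2 fun f hf => ?_)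
  · rw [← homogeneousComponent_eq_self hp.2]
    exact homogeneousComponent_mem_span hs hp.1
  · exact ⟨Ideal.subset_span hf, hs f hf⟩

lemma IsRegularListMod.finrank_span {fs : List (MvPolynomial σ K)} {e : ℕ} (he : 1 ≤ e)
    (hfs : ∀ f ∈ fs, f.IsHomogeneous e) (h : IsRegularListMod ⊥ fs) :
    Module.finrank K (Submodule.span K {f | f ∈ fs}) = fs.length := by
  induction fs with
  | nil =>
    have : {f : MvPolynomial σ K | f ∈ ([] : List (MvPolynomial σ K))} = ∅ := by simp
    rw [this, Submodule.span_empty, finrank_bot, List.length_nil]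
  | cons f gs ih =>
    have hgs : ∀ g ∈ gs, g.IsHomogeneous e := fun g hg => hfs g (by simp [hg])
    have hfin : FiniteDimensional K (Submodule.span K {g | g ∈ gs}) :=
      FiniteDimensional.span_of_finite K gs.finite_toSet
    have hnot : f ∉ Submodule.span K {g | g ∈ gs} := by
      intro hmem
      have h1 : f ∈ Ideal.ofList gs :=
        Submodule.span_le_restrictScalars K (MvPolynomial σ K) _ hmem
      have h2 := h.1 1 (by simpa using h1)
      rw [bot_sup_eq] at h2
      have h3 : Ideal.ofList gs ≤ idealOfVars σ K :=
        Ideal.span_le.2 fun g hg => mem_idealOfVars (hgs g hg) he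
      exact isMaximal_idealOfVars.ne_top ((Ideal.eq_top_iff_one _).2 (h3 h2))
    have hset : {x | x ∈ f :: gs} = {x | x ∈ gs} ∪ {f} := by
      ext x
      simp
    rw [hset, Submodule.span_union, finrank_sup_span_singleton_of_notMem hnot, ih hgs h.2,
      List.length_cons]

end Generators

section Quadrics

variable {σ K : Type*} [Field K]

lemma homogeneousSubmodule_two_induction {N : Submodule K (MvPolynomial σ K)}
    (h : ∀ i j, X i * X j ∈ N) : homogeneousSubmodule σ K 2 ≤ N := by
  rw [← homogeneousSubmodule_one_pow, pow_two, homogeneousSubmodule_one_eq_span_X,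
    Submodule.span_mul_span, Submodule.span_le]
  rintro _ ⟨_, ⟨i, rfl⟩, _, ⟨j, rfl⟩, rfl⟩
  exact h i j

lemma eval_add_smul_of_isHomogeneous_two {q : MvPolynomial σ K} (hq : q.IsHomogeneous 2)
    (a b : σ → K) (z : K) : eval (a + z • b) q =
      eval b q * (z * z) + (eval (a + b) q - eval a q - eval b q) * z + eval a q := by
  let ev : (σ → K) → MvPolynomial σ K →ₗ[K] K := fun x => (aeval x).toLinearMap
  have : homogeneousSubmodule σ K 2 ≤ LinearMap.eqLocus (ev (a + z • b))
      ((z * z) • ev b + z • (ev (a + b) - ev a - ev b) + ev a) := by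
    refine homogeneousSubmodule_two_induction fun i j => ?_
    simp [ev]
    ring
  have h := this hq
  simp only [ev, LinearMap.mem_eqLocus, AlgHom.toLinearMap_apply, LinearMap.add_apply,
    LinearMap.sub_apply, LinearMap.smul_apply, smul_eq_mul, aeval_eq_eval] at h
  rw [h]
  ring

lemma exists_eval_eq_zero_of_isHomogeneous_two [IsAlgClosed K] [NeZero (2 : K)]
    {q : MvPolynomial σ K} (hq : q.IsHomogeneous 2) (a b : σ → K) :
    eval b q = 0 ∨ ∃ z : K, eval (a + z • b) q = 0 := by
  by_cases hb : eval b q = 0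
  · exact Or.inl hb
  · obtain ⟨z, hz⟩ := exists_quadratic_eq_zero hb
      (b := eval (a + b) q - eval a q - eval b q) (c := eval a q) (IsAlgClosed.exists_eq_mul_self _)
    exact Or.inr ⟨z, by rw [eval_add_smul_of_isHomogeneous_two hq, hz]⟩

end Quadrics

end MvPolynomial

lemma Submodule.finrank_map_add_finrank_inf_ker {K V W : Type*} [Field K] [AddCommGroup V]
    [Module K V] [AddCommGroup W] [Module K W] (f : V →ₗ[K] W) (U : Submodule K V)
    [FiniteDimensional K U] :
    finrank K (U.map f) + finrank K (U ⊓ LinearMap.ker f : Submodule K V) = finrank K U := by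
  rw [← LinearMap.finrank_range_add_finrank_ker (f.domRestrict U), LinearMap.range_domRestrict,
    LinearMap.ker_domRestrict, ← Submodule.finrank_map_subtype_eq, Submodule.map_comap_subtype]

section Restriction

variable {l : Submodule ℂ (Fin 5 → ℂ)}

/-- Restriction of polynomials to `l` in the coordinates given by a basis of `l`. -/
def restrictCoord {ι : Type*} [Fintype ι] (v : Basis ι ℂ l) :
    MvPolynomial (Fin 5) ℂ →ₐ[ℂ] MvPolynomial ι ℂ :=
  aeval fun i => ∑ j, C ((v j : Fin 5 → ℂ) i) * X j

variable {ι : Type*} [Fintype ι]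

lemma eval_restrictCoord (v : Basis ι ℂ l) (p : MvPolynomial (Fin 5) ℂ) (x : l) :
    eval (v.repr x) (restrictCoord v p) = restrictTo l p x := by
  have hx : ∀ i, ∑ j, (v j : Fin 5 → ℂ) i * v.repr x j = (x : Fin 5 → ℂ) i := by
    intro i
    have := congrArg (fun y : l => (y : Fin 5 → ℂ) i) (v.sum_repr x)
    simp only [AddSubmonoidClass.coe_finsetSum, Submodule.coe_smul, Finset.sum_apply,
      Pi.smul_apply, smul_eq_mul] at this
    simpa only [mul_comm] using this
  have : ((aeval (v.repr x) : MvPolynomial ι ℂ →ₐ[ℂ] ℂ).comp (restrictCoord v)) =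
      aeval (x : Fin 5 → ℂ) := by
    ext i
    simp [restrictCoord, hx]
  have h := DFunLike.congr_fun this p
  simpa [restrictTo] using h

lemma restrictTo_eq_zero_iff (v : Basis ι ℂ l) (p : MvPolynomial (Fin 5) ℂ) :
    restrictTo l p = 0 ↔ restrictCoord v p = 0 := by
  refine ⟨fun h => MvPolynomial.funext fun t => ?_, fun h => funext fun x => ?_⟩
  · have := eval_restrictCoord v p (v.equivFun.symm t)
    have ht : ⇑(v.repr (v.equivFun.symm t)) = t := v.equivFun.apply_symm_apply t
    rw [h, ht] at this
    rw [this, map_zero, Pi.zero_apply]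
  · rw [← eval_restrictCoord v, h]
    simp

lemma restrictCoord_isHomogeneous (v : Basis ι ℂ l) {p : MvPolynomial (Fin 5) ℂ} {d : ℕ}
    (hp : p.IsHomogeneous d) : (restrictCoord v p).IsHomogeneous d := by
  have := hp.aeval (fun i => ∑ j, C ((v j : Fin 5 → ℂ) i) * X j : Fin 5 → MvPolynomial ι ℂ)
    (n := 1) fun i => IsHomogeneous.sum _ _ _ fun j _ => isHomogeneous_C_mul_X _ _
  rwa [one_mul] at this

lemma exists_restrictCoord_section (v : Basis ι ℂ l) :
    ∃ τ : MvPolynomial ι ℂ →ₐ[ℂ] MvPolynomial (Fin 5) ℂ,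
      (∀ p, restrictCoord v (τ p) = p) ∧ ∀ d p, p.IsHomogeneous d → (τ p).IsHomogeneous d := by
  choose g hg using fun j => LinearMap.exists_extend (v.coord j)
  let y : ι → MvPolynomial (Fin 5) ℂ := fun j => ∑ i, C (g j (Pi.single i 1)) * X i
  have hy : ∀ j, (y j).IsHomogeneous 1 := fun j =>
    IsHomogeneous.sum _ _ _ fun i _ => isHomogeneous_C_mul_X _ _
  refine ⟨aeval y, fun p => ?_, fun d p hp => ?_⟩
  · have : (restrictCoord v).comp (aeval y) = AlgHom.id ℂ (MvPolynomial ι ℂ) := by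
      classical
      ext1 j
      have hk : ∀ k, ∑ i, g j (Pi.single i 1) * (v k : Fin 5 → ℂ) i = if k = j then 1 else 0 := by
        intro k
        have h1 : g j (v k : Fin 5 → ℂ) = v.coord j (v k) := by
          rw [← hg j]
          rfl
        rw [v.coord_apply, v.repr_self, Finsupp.single_apply] at h1
        rw [← h1]
        conv_rhs => rw [pi_eq_sum_univ' (v k : Fin 5 → ℂ), map_sum]
        refine Finset.sum_congr rfl fun i _ => ?_
        rw [map_smul, smul_eq_mul, mul_comm]
      have : restrictCoord v (y j) =
          ∑ k, C (∑ i, g j (Pi.single i 1) * (v k : Fin 5 → ℂ) i) * X k := by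
        simp only [y, restrictCoord, map_sum, map_mul, aeval_X, algHom_C, algebraMap_eq,
          Finset.mul_sum, Finset.sum_mul]
        rw [Finset.sum_comm]
        refine Finset.sum_congr rfl fun k _ => Finset.sum_congr rfl fun i _ => ?_
        ring
      simp [this, hk]
    exact DFunLike.congr_fun this p
  · have := hp.aeval y hy
    rwa [one_mul] at this

lemma mulS1_vanishingForms (l : Submodule ℂ (Fin 5 → ℂ)) : mulS1 (vanishingForms l) =
    homogeneousSubmodule (Fin 5) ℂ 2 ⊓ LinearMap.ker (restrictTo l) := by
  let v := Module.finBasis ℂ l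
  obtain ⟨τ, hτ, hτh⟩ := exists_restrictCoord_section v
  refine le_antisymm (Submodule.span_le.2 ?_) fun p hp => ?_
  · rintro _ ⟨η, hη, η', hη', rfl⟩
    refine ⟨IsHomogeneous.mul hη.1 hη', ?_⟩
    have := hη.2
    rw [SetLike.mem_coe, LinearMap.mem_ker, restrictTo_eq_zero_iff v] at this ⊢
    rw [map_mul, this, zero_mul]
  · let N : Submodule ℂ (MvPolynomial (Fin 5) ℂ) := (mulS1 (vanishingForms l)).comap
      (LinearMap.id - (τ.comp (restrictCoord v)).toLinearMap)
    have hform : ∀ i, X i - τ (restrictCoord v (X i)) ∈ vanishingForms l := fun i =>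
      ⟨(isHomogeneous_X ℂ i).sub (hτh 1 _ (restrictCoord_isHomogeneous v (isHomogeneous_X ℂ i))), by
        rw [SetLike.mem_coe, LinearMap.mem_ker, restrictTo_eq_zero_iff v, map_sub, hτ, sub_self]⟩
    have hN : homogeneousSubmodule (Fin 5) ℂ 2 ≤ N := by
      refine homogeneousSubmodule_two_induction fun i j => ?_
      have e : X i * X j - τ (restrictCoord v (X i * X j)) =
          (X i - τ (restrictCoord v (X i))) * X j +
          (X j - τ (restrictCoord v (X j))) * τ (restrictCoord v (X i)) := by
        rw [map_mul, map_mul]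
        ring
      change X i * X j - τ (restrictCoord v (X i * X j)) ∈ mulS1 (vanishingForms l)
      rw [e]
      exact add_mem (Submodule.subset_span ⟨_, hform i, _, isHomogeneous_X ℂ j, rfl⟩)
        (Submodule.subset_span ⟨_, hform j, _,
          hτh 1 _ (restrictCoord_isHomogeneous v (isHomogeneous_X ℂ i)), rfl⟩)
    have h : p - τ (restrictCoord v p) ∈ mulS1 (vanishingForms l) := hN hp.1
    rwa [(restrictTo_eq_zero_iff v p).1 hp.2, map_zero, sub_zero] at h

lemma finrank_map_restrictTo (l : Submodule ℂ (Fin 5 → ℂ)) (d : ℕ) :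
    finrank ℂ ((homogeneousSubmodule (Fin 5) ℂ d).map (restrictTo l)) =
      (finrank ℂ l + d - 1).choose d := by
  let v := Module.finBasis ℂ l
  obtain ⟨τ, hτ, hτh⟩ := exists_restrictCoord_section v
  have hmap : (homogeneousSubmodule (Fin 5) ℂ d).map (restrictCoord v).toLinearMap =
      homogeneousSubmodule (Fin (finrank ℂ l)) ℂ d := by
    refine le_antisymm ?_ fun p hp => ⟨τ p, hτh d p hp, hτ p⟩
    rintro _ ⟨p, hp, rfl⟩
    exact restrictCoord_isHomogeneous v hp
  have hker : LinearMap.ker (restrictTo l) = LinearMap.ker (restrictCoord v).toLinearMap := by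
    ext p
    simp [restrictTo_eq_zero_iff v]
  have h1 := Submodule.finrank_map_add_finrank_inf_ker (restrictTo l)
    (homogeneousSubmodule (Fin 5) ℂ d)
  have h2 := Submodule.finrank_map_add_finrank_inf_ker (restrictCoord v).toLinearMap
    (homogeneousSubmodule (Fin 5) ℂ d)
  rw [hmap, ← hker, finrank_homogeneousSubmodule, Fintype.card_fin] at h2
  omega

end Restriction

section Jacobian

variable {E : MvPolynomial (Fin 5) ℂ}

lemma jacobianIdeal_eq_ofList (E : MvPolynomial (Fin 5) ℂ) :
    jacobianIdeal E = Ideal.ofList (List.ofFn fun i => pderiv i E) := by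
  rw [jacobianIdeal, Ideal.ofList]
  congr 1
  ext p
  simp only [Set.mem_range, Set.mem_ofPred_eq, List.mem_ofFn]

lemma IsSmoothCubic.pderiv_isHomogeneous (hE : IsSmoothCubic E) (i : Fin 5) :
    (pderiv i E).IsHomogeneous 2 :=
  hE.1.pderiv

lemma IsSmoothCubic.idealOfVars_le_radical (hE : IsSmoothCubic E) :
    idealOfVars (Fin 5) ℂ ≤ (jacobianIdeal E).radical :=
  MvPolynomial.idealOfVars_le_radical fun x hx =>
    hE.2 x fun i => hx _ (Ideal.subset_span (Set.mem_range_self i))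

lemma IsSmoothCubic.isRegularListMod_and_hasSocleInDegree (hE : IsSmoothCubic E) :
    IsRegularListMod ⊥ (List.ofFn fun i => pderiv i E) ∧
      HasSocleInDegree (jacobianIdeal E) (3 + 2) := by
  have hspan : Ideal.span ((⊥ : Submodule ℂ (MvPolynomial (Fin 5) ℂ)) :
      Set (MvPolynomial (Fin 5) ℂ)) = ⊥ := by simp
  have h := MvPolynomial.isRegularListMod_and_hasSocleInDegree (K := ℂ) (σ := Fin 5)
    (fs := List.ofFn fun i => pderiv i E) (U := ⊥)
    (by
      intro f hf
      obtain ⟨i, rfl⟩ := List.mem_ofFn.1 hf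
      exact hE.pderiv_isHomogeneous i)
    bot_le
    (by rw [finrank_bot, finrank_homogeneousSubmodule]; simp)
    (by
      rw [hspan, bot_sup_eq, ← jacobianIdeal_eq_ofList]
      exact hE.idealOfVars_le_radical)
  rw [hspan, bot_sup_eq, ← jacobianIdeal_eq_ofList, List.length_ofFn] at h
  exact h

lemma IsSmoothCubic.finrank_J2 (hE : IsSmoothCubic E) : finrank ℂ (J2 E) = 5 := by
  have hh : ∀ f ∈ List.ofFn fun i => pderiv i E, f.IsHomogeneous 2 := by
    intro f hf
    obtain ⟨i, rfl⟩ := List.mem_ofFn.1 hf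
    exact hE.pderiv_isHomogeneous i
  rw [J2, jacobianIdeal_eq_ofList, Ideal.ofList,
    restrictScalars_span_inf_homogeneousSubmodule
      (s := {f | f ∈ List.ofFn fun i => pderiv i E}) hh,
    hE.isRegularListMod_and_hasSocleInDegree.1.finrank_span one_le_two hh, List.length_ofFn]

lemma IsSmoothCubic.two_le_finrank_map_restrictTo (hE : IsSmoothCubic E)
    {l : Submodule ℂ (Fin 5 → ℂ)} (hl : finrank ℂ l = 2) :
    2 ≤ finrank ℂ ((J2 E).map (restrictTo l)) := by
  have : FiniteDimensional ℂ (J2 E) := Submodule.finiteDimensional_of_le inf_le_right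
  by_contra! hlt
  obtain ⟨⟨_, q, hq, rfl⟩, hw⟩ := finrank_le_one_iff.1 (Nat.lt_succ_iff.1 hlt)
  have hzero : ∀ x : l, eval (x : Fin 5 → ℂ) q = 0 → x = 0 := by
    intro x hx
    refine Subtype.ext (hE.2 x fun i => ?_)
    obtain ⟨c, hc⟩ := hw ⟨restrictTo l (pderiv i E), Submodule.mem_map_of_mem
      ⟨Ideal.subset_span (Set.mem_range_self i), hE.pderiv_isHomogeneous i⟩⟩
    have h : c * eval (x : Fin 5 → ℂ) q = eval (x : Fin 5 → ℂ) (pderiv i E) :=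
      congrFun (congrArg Subtype.val hc) x
    rw [← h, hx, mul_zero]
  let v := Module.finBasisOfFinrankEq ℂ l hl
  rcases exists_eval_eq_zero_of_isHomogeneous_two hq.2 (v 0 : Fin 5 → ℂ) (v 1) with h | ⟨z, h⟩
  · exact v.ne_zero 1 (hzero _ h)
  · have h0 := hzero (v 0 + z • v 1) h
    have := congrArg (fun x => v.repr x 0) h0
    simp at this

lemma IsSmoothCubic.exists_mul_mem_iff (hE : IsSmoothCubic E) (l : Submodule ℂ (Fin 5 → ℂ)) :
    (∃ ξ : MvPolynomial (Fin 5) ℂ, ξ.IsHomogeneous 3 ∧ ξ ∉ jacobianIdeal E ∧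
        ∀ η ∈ vanishingForms l, η * ξ ∈ jacobianIdeal E) ↔
      ¬ homogeneousSubmodule (Fin 5) ℂ 2 ≤ J2 E ⊔ mulS1 (vanishingForms l) := by
  have hsoc := hE.isRegularListMod_and_hasSocleInDegree.2
  have hrad := hE.idealOfVars_le_radical
  constructor
  · rintro ⟨ξ, hξ, hξJ, hann⟩ hle
    obtain ⟨e, θ, he, hθ, hθξ⟩ := hsoc.exists_mul_notMem hrad hξ hξJ
    obtain rfl : e = 2 := by omega
    have hsup : J2 E ⊔ mulS1 (vanishingForms l) ≤
        ((jacobianIdeal E).restrictScalars ℂ).comap (LinearMap.mulRight ℂ ξ) := by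
      refine sup_le (fun p hp => Ideal.mul_mem_right _ _ hp.1) (Submodule.span_le.2 ?_)
      rintro _ ⟨η, hη, η', -, rfl⟩
      have h : η' * (η * ξ) ∈ jacobianIdeal E := Ideal.mul_mem_left _ _ (hann η hη)
      have e : η * η' * ξ = η' * (η * ξ) := by ring
      rw [← e] at h
      exact h
    exact hθξ (hsup (hle hθ))
  · intro hle
    obtain ⟨ξ, hξ, hξJ, hann⟩ := hsoc.exists_annihilator hrad
      (N := (J2 E ⊔ mulS1 (vanishingForms l)).comap (homogeneousSubmodule (Fin 5) ℂ 2).subtype)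
      (fun h => hle (Submodule.comap_subtype_eq_top.1 h))
      (fun x hx => Submodule.mem_sup_left ⟨hx, x.2⟩)
    refine ⟨ξ, hξ, hξJ, fun η hη => ?_⟩
    by_contra hηξ
    obtain ⟨e, θ, he, hθ, hθη⟩ := hsoc.exists_mul_notMem hrad (IsHomogeneous.mul hη.1 hξ) hηξ
    obtain rfl : e = 1 := by omega
    have h := hann ⟨η * θ, IsHomogeneous.mul hη.1 hθ⟩
      (Submodule.mem_sup_right (Submodule.subset_span ⟨η, hη, θ, hθ, rfl⟩))
    have e : ξ * (η * θ) = θ * (η * ξ) := by ring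
    exact hθη (e ▸ h)

lemma homogeneousSubmodule_two_le_iff {l : Submodule ℂ (Fin 5 → ℂ)} (hl : finrank ℂ l = 2) :
    homogeneousSubmodule (Fin 5) ℂ 2 ≤ J2 E ⊔ mulS1 (vanishingForms l) ↔
      3 ≤ finrank ℂ ((J2 E).map (restrictTo l)) := by
  have : FiniteDimensional ℂ (J2 E) := Submodule.finiteDimensional_of_le inf_le_right
  have hfin := finrank_map_restrictTo l 2
  rw [hl] at hfin
  have hmap : (J2 E).map (restrictTo l) ≤
      (homogeneousSubmodule (Fin 5) ℂ 2).map (restrictTo l) := Submodule.map_mono inf_le_right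
  rw [mulS1_vanishingForms]
  constructor
  · intro h
    have h' := Submodule.map_mono (f := restrictTo l) h
    rw [Submodule.map_sup, LinearMap.le_ker_iff_map.1 inf_le_right,
      sup_bot_eq] at h'
    exact hfin.symm.le.trans (Submodule.finrank_mono h')
  · intro h p hp
    have heq := Submodule.eq_of_le_of_finrank_le hmap (hfin.le.trans h)
    obtain ⟨q, hq, hqp⟩ := heq.ge (Submodule.mem_map_of_mem hp)
    refine Submodule.mem_sup.2 ⟨q, hq, p - q, ⟨sub_mem hp hq.2, ?_⟩, by ring⟩
    rw [SetLike.mem_coe, LinearMap.mem_ker, map_sub, hqp, sub_self]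

end Jacobian

/-- For a line `l ⊆ ℙ⁴` (a 2-dimensional linear subspace of `ℂ⁵`) with `W ⊆ S¹` its space
of vanishing linear forms, the following are equivalent:
(a) there is `ξ ∈ S³ \ J` with `η·ξ ∈ J` for all `η ∈ W`;
(b) the image of `W·S¹` in `R² = S²/J₂` is a hyperplane (dimension 9);
(c) `dim ((W·S¹) ∩ J₂) = 3`;
(d) the space of restrictions to `l` of elements of `J₂` has dimension 2. -/
theorem statement4 (E : MvPolynomial (Fin 5) ℂ) (hE : IsSmoothCubic E)
    (l : Submodule ℂ (Fin 5 → ℂ)) (hl : finrank ℂ l = 2) :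
    ((∃ ξ : MvPolynomial (Fin 5) ℂ, ξ.IsHomogeneous 3 ∧ ξ ∉ jacobianIdeal E ∧
        ∀ η ∈ vanishingForms l, η * ξ ∈ jacobianIdeal E) ↔
      finrank ℂ (Submodule.map (Submodule.mkQ ((jacobianIdeal E).restrictScalars ℂ))
        (mulS1 (vanishingForms l))) = 9) ∧
    ((∃ ξ : MvPolynomial (Fin 5) ℂ, ξ.IsHomogeneous 3 ∧ ξ ∉ jacobianIdeal E ∧
        ∀ η ∈ vanishingForms l, η * ξ ∈ jacobianIdeal E) ↔
      finrank ℂ (mulS1 (vanishingForms l) ⊓ (jacobianIdeal E).restrictScalars ℂ :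
        Submodule ℂ (MvPolynomial (Fin 5) ℂ)) = 3) ∧
    ((∃ ξ : MvPolynomial (Fin 5) ℂ, ξ.IsHomogeneous 3 ∧ ξ ∉ jacobianIdeal E ∧
        ∀ η ∈ vanishingForms l, η * ξ ∈ jacobianIdeal E) ↔
      finrank ℂ (Submodule.map (restrictTo l) (J2 E)) = 2) := by
  have hK := mulS1_vanishingForms l
  have hKle : mulS1 (vanishingForms l) ≤ homogeneousSubmodule (Fin 5) ℂ 2 := hK ▸ inf_le_left
  have : FiniteDimensional ℂ (mulS1 (vanishingForms l)) := Submodule.finiteDimensional_of_le hKle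
  have : FiniteDimensional ℂ (J2 E) := Submodule.finiteDimensional_of_le inf_le_right
  have hinf : mulS1 (vanishingForms l) ⊓ (jacobianIdeal E).restrictScalars ℂ =
      J2 E ⊓ LinearMap.ker (restrictTo l) := by
    rw [hK, J2, inf_right_comm, inf_comm (homogeneousSubmodule (Fin 5) ℂ 2)]
  have h₁ := Submodule.finrank_map_add_finrank_inf_ker (restrictTo l)
    (homogeneousSubmodule (Fin 5) ℂ 2)
  rw [← hK, finrank_map_restrictTo, hl, finrank_homogeneousSubmodule, Fintype.card_fin] at h₁
  have h₂ := Submodule.finrank_map_add_finrank_inf_ker (restrictTo l) (J2 E)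
  rw [← hinf, hE.finrank_J2] at h₂
  have h₃ := Submodule.finrank_map_add_finrank_inf_ker
    (Submodule.mkQ ((jacobianIdeal E).restrictScalars ℂ)) (mulS1 (vanishingForms l))
  rw [Submodule.ker_mkQ] at h₃
  have h₄ := hE.two_le_finrank_map_restrictTo hl
  have h₅ : (2 + 2 - 1).choose 2 = 3 := rfl
  have h₆ : (5 + 2 - 1).choose 2 = 15 := rfl
  rw [hE.exists_mul_mem_iff, homogeneousSubmodule_two_le_iff hl]
  omega
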